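/- arXiv:2508.03308 — 2 statements merged into one kernel-verified Lean document; each statement's English description precedes it below -/
import Mathlib

section
/- Let d be a prime and let c_0 ∈ ℂ be a root of the Gleason polynomial G_{d,n} for some n ≥ 2. Set K = ℚ(c_0). Let k_1, k_2 ≥ 0 and 1 ≤ i_1, i_2 ≤ n − 1. Then the polynomials F_{k_1,i_1}^{(d,c_0)} and F_{k_2,i_2}^{(d,c_0)} have a nonconstant common divisor in K[x] (equivalently, a common root in ℂ) if and only if (k_1, i_1) = (k_2, i_2). -/
open Polynomial IntermediateField

noncomputable section

/-- The value sequence `a_i(c)`: `a_0 = 0`, `a_{i+1} = a_i ^ d + c`. -/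
def aSeq (d : ℕ) {F : Type*} [CommRing F] (c : F) : ℕ → F
  | 0 => 0
  | i + 1 => aSeq d c i ^ d + c

/-- The polynomials `a_i ∈ ℤ[c]`: `a_0 = 0`, `a_{i+1} = a_i ^ d + c`. -/
def aPoly (d : ℕ) : ℕ → Polynomial ℤ
  | 0 => 0
  | i + 1 => aPoly d i ^ d + X

/-- Iterates of `f_{d,c} = x^d + c`: `f^0 = x`, `f^{k+1} = f ∘ f^k`. -/
def fIter (d : ℕ) {F : Type*} [CommRing F] (c : F) : ℕ → Polynomial F
  | 0 => X
  | k + 1 => fIter d c k ^ d + C c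

/-- `c₀` is a root of the Gleason polynomial `G_{d,n} = ∏_{k ∣ n} a_k^{μ(n/k)}`. -/
def isGleasonRoot (d n : ℕ) (c₀ : ℂ) : Prop :=
  ∃ g : Polynomial ℤ,
    g * ∏ k ∈ n.divisors, aPoly d k ^ ((-(ArithmeticFunction.moebius (n / k))).toNat)
        = ∏ k ∈ n.divisors, aPoly d k ^ ((ArithmeticFunction.moebius (n / k)).toNat)
    ∧ Polynomial.aeval c₀ g = 0

/-- `c₀` is a root of the Misiurewicz polynomial `G_{d,m,n}^ζ`. -/
def isMisiurewiczRoot (d m n : ℕ) (ζ c₀ : ℂ) : Prop :=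
  ∃ g : Polynomial ℂ,
    g * ((∏ k ∈ n.divisors,
            ((aPoly d (m + k - 1)).map (Int.castRingHom ℂ) -
              C ζ * (aPoly d (m - 1)).map (Int.castRingHom ℂ))
                ^ ((-(ArithmeticFunction.moebius (n / k))).toNat)) *
          (if n ∣ (m - 1) then
            ∏ k ∈ n.divisors, ((aPoly d k).map (Int.castRingHom ℂ))
                ^ ((ArithmeticFunction.moebius (n / k)).toNat)
          else 1))
        = (∏ k ∈ n.divisors,
            ((aPoly d (m + k - 1)).map (Int.castRingHom ℂ) -
              C ζ * (aPoly d (m - 1)).map (Int.castRingHom ℂ))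
                ^ ((ArithmeticFunction.moebius (n / k)).toNat)) *
          (if n ∣ (m - 1) then
            ∏ k ∈ n.divisors, ((aPoly d k).map (Int.castRingHom ℂ))
                ^ ((-(ArithmeticFunction.moebius (n / k))).toNat)
          else 1)
    ∧ g.eval c₀ = 0

/-- The polynomial `F_{k,i}^{(d,c₀)} = ∏_{j=1}^{d-1} (f_{d,c₀}^k - ζ^j a_i(c₀))` over `ℂ`. -/
def FPoly (d : ℕ) (c₀ ζ : ℂ) (k i : ℕ) : Polynomial ℂ :=
  ∏ j ∈ Finset.Icc 1 (d - 1), (fIter d c₀ k - C (ζ ^ j * aSeq d c₀ i))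

theorem map_aPoly_eval (d : ℕ) (c : ℂ) (k : ℕ) :
    ((aPoly d k).map (Int.castRingHom ℂ)).eval c = aSeq d c k := by
  induction k with
  | zero => simp [aPoly, aSeq]
  | succ k ih => simp [aPoly, aSeq, ih]

theorem aSeq_eq_iterate (d : ℕ) (c : ℂ) (k : ℕ) :
    aSeq d c k = (fun x => x ^ d + c)^[k] (0 : ℂ) := by
  induction k with
  | zero => rfl
  | succ k ih => rw [Function.iterate_succ_apply', ← ih]; rfl

theorem fIter_eval (d : ℕ) (c z : ℂ) (k : ℕ) :
    (fIter d c k).eval z = (fun x => x ^ d + c)^[k] z := by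
  induction k with
  | zero => simp [fIter]
  | succ k ih => rw [Function.iterate_succ_apply', ← ih]; simp [fIter]

theorem natDegree_fIter (d : ℕ) (c : ℂ) (k : ℕ) : (fIter d c k).natDegree = d ^ k := by
  induction k with
  | zero => simp [fIter]
  | succ k ih => rw [fIter, natDegree_add_C, natDegree_pow, ih, pow_succ']

theorem FPoly_eval_eq_zero_iff (d : ℕ) (c ζ z : ℂ) (k i : ℕ) :
    (FPoly d c ζ k i).eval z = 0 ↔
      ∃ j ∈ Finset.Icc 1 (d - 1), (fun x => x ^ d + c)^[k] z = ζ ^ j * aSeq d c i := by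
  simp only [FPoly, eval_prod, Finset.prod_eq_zero_iff, eval_sub, eval_C, fIter_eval, sub_eq_zero]

theorem aPoly_succ_monic {d : ℕ} (hd : 2 ≤ d) (k : ℕ) :
    (aPoly d (k + 1)).Monic ∧ 1 ≤ (aPoly d (k + 1)).natDegree := by
  induction k with
  | zero =>
    have h : aPoly d (0 + 1) = X := by
      simp [aPoly, show d ≠ 0 by lia]
    rw [h]
    exact ⟨monic_X, by simp⟩
  | succ k ih =>
    obtain ⟨hm, hdeg⟩ := ih
    have hlt : (X : ℤ[X]).natDegree < (aPoly d (k + 1) ^ d).natDegree := by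
      rw [hm.natDegree_pow, natDegree_X]
      nlinarith
    refine ⟨(hm.pow d).add_of_left (degree_lt_degree hlt), ?_⟩
    rw [aPoly, natDegree_add_eq_left_of_natDegree_lt hlt]
    exact (natDegree_X (R := ℤ) ▸ hlt).le

theorem derivative_aPoly_succ (d k : ℕ) :
    ∃ q : ℤ[X], derivative (aPoly d (k + 1)) = C (d : ℤ) * q + 1 := by
  refine ⟨aPoly d k ^ (d - 1) * derivative (aPoly d k), ?_⟩
  rw [aPoly, derivative_add, derivative_pow, derivative_X]
  simp [mul_assoc]

theorem not_isIntegral_of_natCast_mul_add_one {d : ℕ} (hd : 2 ≤ d) {x : ℂ}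
    (hx : (d : ℂ) * x + 1 = 0) : ¬ IsIntegral ℤ x := by
  intro hint
  have hd0 : (d : ℚ) ≠ 0 := by positivity
  have hd1 : (d : ℂ) ≠ 0 := by exact_mod_cast hd0
  have hxq : x = algebraMap ℚ ℂ (-1 / d) := by
    push_cast [eq_ratCast]
    field_simp
    linear_combination hx
  rw [hxq, isIntegral_algebraMap_iff (algebraMap ℚ ℂ).injective] at hint
  obtain ⟨y, hy⟩ := IsIntegrallyClosed.isIntegral_iff.mp hint
  rw [eq_intCast, eq_div_iff hd0] at hy
  have hy' : y * d = -1 := by exact_mod_cast hy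
  have hu : IsUnit (d : ℤ) := .of_mul_eq_one (-y) (by linear_combination -hy')
  rw [Int.isUnit_iff] at hu
  lia

theorem rootMultiplicity_aPoly {d : ℕ} (hd : 2 ≤ d) (c : ℂ) {k : ℕ} (hk : k ≠ 0) :
    rootMultiplicity c ((aPoly d k).map (Int.castRingHom ℂ)) =
      if aSeq d c k = 0 then 1 else 0 := by
  obtain ⟨k, rfl⟩ := Nat.exists_eq_succ_of_ne_zero hk
  have hmon := (aPoly_succ_monic hd k).1
  have hne : (aPoly d (k + 1)).map (Int.castRingHom ℂ) ≠ 0 := (hmon.map _).ne_zero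
  split_ifs with h
  · have hroot : ((aPoly d (k + 1)).map (Int.castRingHom ℂ)).IsRoot c := by
      rw [IsRoot, map_aPoly_eval, h]
    refine le_antisymm ?_ ((rootMultiplicity_pos hne).mpr hroot)
    by_contra! hlt
    have hder := ((one_lt_rootMultiplicity_iff_isRoot hne).mp hlt).2
    obtain ⟨q, hq⟩ := derivative_aPoly_succ d k
    rw [derivative_map, hq] at hder
    have hc : IsIntegral ℤ c := ⟨_, hmon, by
      simpa [eval_map] using hroot⟩
    have hqint : IsIntegral ℤ ((q.map (Int.castRingHom ℂ)).eval c) := by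
      rw [eval_map]
      exact adjoin_le_integralClosure hc (aeval_mem_adjoin_singleton ℤ c (p := q))
    refine not_isIntegral_of_natCast_mul_add_one hd ?_ hqint
    simpa using hder
  · refine rootMultiplicity_eq_zero ?_
    rwa [IsRoot, map_aPoly_eval]

theorem rootMultiplicity_prod_pow {ι : Type*} (s : Finset ι) (f : ι → ℂ[X]) (e : ι → ℕ)
    (c : ℂ) (hf : ∀ i ∈ s, f i ≠ 0) :
    rootMultiplicity c (∏ i ∈ s, f i ^ e i) = ∑ i ∈ s, e i * rootMultiplicity c (f i) := by
  classical
  induction s using Finset.induction_on with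
  | empty => simp
  | insert a s ha ih =>
    have hs : ∀ i ∈ s, f i ≠ 0 := fun i hi => hf i (Finset.mem_insert_of_mem hi)
    have ha0 : f a ≠ 0 := hf a (Finset.mem_insert_self a s)
    have hne : ∏ i ∈ s, f i ^ e i ≠ 0 :=
      Finset.prod_ne_zero_iff.mpr fun i hi => pow_ne_zero _ (hs i hi)
    rw [Finset.prod_insert ha, Finset.sum_insert ha,
      rootMultiplicity_mul (mul_ne_zero (pow_ne_zero _ ha0) hne), ih hs,
      ← count_roots, roots_pow, Multiset.count_nsmul, count_roots]

theorem sum_moebius_div_of_dvd {m n : ℕ} (hn : n ≠ 0) (hmn : m ∣ n) :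
    ∑ k ∈ n.divisors, ArithmeticFunction.moebius (n / k) * (if m ∣ k then 1 else 0) =
      if m = n then 1 else 0 := by
  have hm : m ≠ 0 := ne_zero_of_dvd_ne_zero hn hmn
  have hfil : {k ∈ n.divisors | m ∣ n / k} = (n / m).divisors := by
    obtain ⟨r, rfl⟩ := hmn
    have hr : r ≠ 0 := right_ne_zero_of_mul hn
    rw [Nat.mul_div_cancel_left _ (Nat.pos_of_ne_zero hm)]
    ext k
    simp only [Finset.mem_filter, Nat.mem_divisors]
    constructor
    · rintro ⟨⟨hk, -⟩, hk'⟩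
      refine ⟨?_, hr⟩
      have := (Nat.dvd_div_iff_mul_dvd hk).mp hk'
      rw [mul_comm k m] at this
      exact (Nat.mul_dvd_mul_iff_left (Nat.pos_of_ne_zero hm)).mp this
    · rintro ⟨hk, -⟩
      refine ⟨⟨hk.mul_left m, hn⟩, ?_⟩
      rw [Nat.dvd_div_iff_mul_dvd (hk.mul_left m), mul_comm k m]
      exact Nat.mul_dvd_mul_left m hk
  have hswap : ∑ k ∈ n.divisors, ArithmeticFunction.moebius (n / k) * (if m ∣ k then 1 else 0) =
      ∑ k ∈ n.divisors, ArithmeticFunction.moebius k * (if m ∣ n / k then 1 else 0) := by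
    rw [← Nat.sum_div_divisors]
    refine Finset.sum_congr rfl fun k hk => ?_
    rw [Nat.div_div_self (Nat.dvd_of_mem_divisors hk) hn]
  rw [hswap]
  simp only [mul_ite, mul_one, mul_zero]
  rw [← Finset.sum_filter, hfil, ← ArithmeticFunction.coe_mul_zeta_apply,
    ArithmeticFunction.moebius_mul_coe_zeta, ArithmeticFunction.one_apply]
  congr 1
  rw [eq_iff_iff, Nat.div_eq_iff_eq_mul_left (Nat.pos_of_ne_zero hm) hmn, one_mul, eq_comm]

theorem minimalPeriod_of_isGleasonRoot {d n : ℕ} (hd : 2 ≤ d) (hn : n ≠ 0) {c : ℂ}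
    (h : isGleasonRoot d n c) :
    Function.minimalPeriod (fun x : ℂ => x ^ d + c) 0 = n := by
  set m := Function.minimalPeriod (fun x : ℂ => x ^ d + c) 0 with hm
  have hzero (k : ℕ) : aSeq d c k = 0 ↔ m ∣ k := by
    rw [aSeq_eq_iterate, hm, ← Function.isPeriodicPt_iff_minimalPeriod_dvd]
    rfl
  have hpos {k : ℕ} (hk : k ∈ n.divisors) : k ≠ 0 := (Nat.pos_of_mem_divisors hk).ne'
  have hne : ∀ k ∈ n.divisors, (aPoly d k).map (Int.castRingHom ℂ) ≠ 0 := by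
    intro k hk
    obtain ⟨k, rfl⟩ := Nat.exists_eq_succ_of_ne_zero (hpos hk)
    exact ((aPoly_succ_monic hd k).1.map _).ne_zero
  obtain ⟨g, hg, hgc⟩ := h
  replace hg := congrArg (Polynomial.map (Int.castRingHom ℂ)) hg
  simp only [Polynomial.map_mul, Polynomial.map_prod, Polynomial.map_pow] at hg
  replace hgc : (g.map (Int.castRingHom ℂ)).eval c = 0 := by
    rw [eval_map]; exact hgc
  have hA : ∏ k ∈ n.divisors, (aPoly d k).map (Int.castRingHom ℂ) ^
      (ArithmeticFunction.moebius (n / k)).toNat ≠ 0 :=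
    Finset.prod_ne_zero_iff.mpr fun k hk => pow_ne_zero _ (hne k hk)
  have hmn : m ∣ n := by
    have h0 := congrArg (eval c) hg
    rw [eval_mul, hgc, zero_mul, eval_prod, eq_comm, Finset.prod_eq_zero_iff] at h0
    obtain ⟨k, hk, hk0⟩ := h0
    rw [eval_pow, map_aPoly_eval] at hk0
    exact ((hzero k).mp (eq_zero_of_pow_eq_zero hk0)).trans (Nat.dvd_of_mem_divisors hk)
  have hmul := congrArg (rootMultiplicity c) hg
  rw [rootMultiplicity_mul (hg ▸ hA), rootMultiplicity_prod_pow _ _ _ _ hne,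
    rootMultiplicity_prod_pow _ _ _ _ hne] at hmul
  have hg0 : g.map (Int.castRingHom ℂ) ≠ 0 := left_ne_zero_of_mul (hg ▸ hA)
  have hgpos := (rootMultiplicity_pos hg0).mpr hgc
  have hsum := sum_moebius_div_of_dvd hn hmn
  have hsplit : ∑ k ∈ n.divisors,
      ArithmeticFunction.moebius (n / k) * (if m ∣ k then 1 else 0) =
      rootMultiplicity c (g.map (Int.castRingHom ℂ)) := by
    have hcast := congrArg (Nat.cast : ℕ → ℤ) hmul
    push_cast at hcast
    rw [eq_sub_of_add_eq hcast, ← Finset.sum_sub_distrib]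
    refine Finset.sum_congr rfl fun k hk => ?_
    rw [rootMultiplicity_aPoly hd c (hpos hk), ← sub_mul, Int.toNat_sub_toNat_neg]
    simp [hzero]
  by_contra hmn'
  rw [hsplit, if_neg hmn'] at hsum
  lia

theorem Function.iterate_eq_of_iterate_succ_eq {α : Type*} {f : α → α} {x : α} {n p q : ℕ}
    (hn : n ≠ 0) (hx : f^[n] x = x) (h : f^[p + 1] x = f^[q + 1] x) : f^[p] x = f^[q] x := by
  have key (r : ℕ) : f^[n - 1] (f^[r + 1] x) = f^[r] x := by
    rw [← Function.iterate_add_apply, show n - 1 + (r + 1) = r + n by lia,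
      Function.iterate_add_apply, hx]
  rw [← key p, ← key q, h]

theorem exists_root_FPoly {d : ℕ} (hd : 2 ≤ d) (c ζ : ℂ) (k i : ℕ) :
    ∃ z : ℂ, (FPoly d c ζ k i).eval z = 0 := by
  obtain ⟨z, hz⟩ := IsAlgClosed.exists_root (fIter d c k - C (ζ ^ 1 * aSeq d c i)) (by
    refine degree_ne_of_natDegree_ne ?_
    rw [natDegree_sub_C, natDegree_fIter]
    positivity)
  refine ⟨z, (FPoly_eval_eq_zero_iff ..).mpr ⟨1, Finset.mem_Icc.mpr ⟨le_rfl, by lia⟩, ?_⟩⟩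
  rwa [IsRoot, eval_sub, eval_C, fIter_eval, sub_eq_zero] at hz

theorem iterate_succ_of_FPoly_eval {d : ℕ} {c ζ z : ℂ} (hζ : IsPrimitiveRoot ζ d) {k i : ℕ}
    (h : (FPoly d c ζ k i).eval z = 0) :
    (fun x => x ^ d + c)^[k + 1] z = (fun x => x ^ d + c)^[i + 1] 0 := by
  obtain ⟨j, -, h⟩ := (FPoly_eval_eq_zero_iff ..).mp h
  rw [Function.iterate_succ_apply', h, Function.iterate_succ_apply', ← aSeq_eq_iterate]
  simp only [mul_pow]
  rw [← pow_mul, mul_comm j, pow_mul, hζ.pow_eq_one, one_pow, one_mul]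

theorem FPoly_root_level_le {d n : ℕ} (hn : n ≠ 0) {c ζ : ℂ} (hζ : IsPrimitiveRoot ζ d)
    (hc : aSeq d c n = 0) {k₁ k₂ i₁ i₂ : ℕ} (hi₂ : aSeq d c i₂ ≠ 0) {z : ℂ}
    (h₁ : (FPoly d c ζ k₁ i₁).eval z = 0) (h₂ : (FPoly d c ζ k₂ i₂).eval z = 0) : k₂ ≤ k₁ := by
  by_contra! hlt
  have hs₁ := iterate_succ_of_FPoly_eval hζ h₁
  have hs₂ := iterate_succ_of_FPoly_eval hζ h₂
  obtain ⟨j₂, hj₂, h₂⟩ := (FPoly_eval_eq_zero_iff ..).mp h₂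
  rw [Finset.mem_Icc] at hj₂
  obtain ⟨r, rfl⟩ := Nat.exists_eq_add_of_lt hlt
  have horb : (fun x => x ^ d + c)^[k₁ + r + 1] z = (fun x => x ^ d + c)^[r + (i₁ + 1)] 0 := by
    rw [show k₁ + r + 1 = r + (k₁ + 1) by lia, Function.iterate_add_apply, hs₁,
      ← Function.iterate_add_apply]
  have hcancel := Function.iterate_eq_of_iterate_succ_eq hn ((aSeq_eq_iterate d c n).symm.trans hc)
    (p := r + (i₁ + 1)) (q := i₂) (by
      rw [← hs₂, Function.iterate_succ_apply', ← horb, Function.iterate_succ_apply' _ (k₁ + r + 1)])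
  rw [← horb, h₂, ← aSeq_eq_iterate, mul_eq_right₀ hi₂, hζ.pow_eq_one_iff_dvd] at hcancel
  have := Nat.le_of_dvd (by lia) hcancel
  lia

/-- For a Gleason parameter `c₀` of period `n ≥ 2`, two of the polynomials
`F_{k₁,i₁}^{(d,c₀)}`, `F_{k₂,i₂}^{(d,c₀)}` (with `1 ≤ i₁, i₂ ≤ n-1`) share a common root in
`ℂ` (equivalently, have a nonconstant common divisor over `K = ℚ(c₀)`) if and only if
`(k₁, i₁) = (k₂, i₂)`. -/
theorem stmt14 (d : ℕ) (hd : Nat.Prime d) (n : ℕ) (hn : 2 ≤ n)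
    (c₀ : ℂ) (hc₀ : isGleasonRoot d n c₀)
    (ζ : ℂ) (hζ : IsPrimitiveRoot ζ d)
    (k₁ k₂ i₁ i₂ : ℕ) (hi₁ : 1 ≤ i₁) (hi₁' : i₁ ≤ n - 1) (hi₂ : 1 ≤ i₂) (hi₂' : i₂ ≤ n - 1) :
    (∃ z : ℂ, (FPoly d c₀ ζ k₁ i₁).eval z = 0 ∧ (FPoly d c₀ ζ k₂ i₂).eval z = 0) ↔
      (k₁, i₁) = (k₂, i₂) := by
  have hper := minimalPeriod_of_isGleasonRoot hd.two_le (by lia) hc₀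
  have hzero (k : ℕ) : aSeq d c₀ k = 0 ↔ n ∣ k := by
    rw [aSeq_eq_iterate, ← hper, ← Function.isPeriodicPt_iff_minimalPeriod_dvd]
    rfl
  have hne {i : ℕ} (h1 : 1 ≤ i) (h2 : i ≤ n - 1) : aSeq d c₀ i ≠ 0 := by
    rw [Ne, hzero]
    exact Nat.not_dvd_of_pos_of_lt h1 (by lia)
  have hc := (hzero n).mpr dvd_rfl
  have hn0 : n ≠ 0 := by lia
  constructor
  · rintro ⟨z, h₁, h₂⟩
    obtain rfl : k₁ = k₂ := le_antisymm
      (FPoly_root_level_le hn0 hζ hc (hne hi₁ hi₁') h₂ h₁)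
      (FPoly_root_level_le hn0 hζ hc (hne hi₂ hi₂') h₁ h₂)
    have h := (iterate_succ_of_FPoly_eval hζ h₁).symm.trans (iterate_succ_of_FPoly_eval hζ h₂)
    have hcancel := Function.iterate_eq_of_iterate_succ_eq hn0
      ((aSeq_eq_iterate d c₀ n).symm.trans hc) h
    have := Function.iterate_injOn_Iio_minimalPeriod (f := fun x : ℂ => x ^ d + c₀) (x := 0)
      (by rw [hper, Set.mem_Iio]; lia) (by rw [hper, Set.mem_Iio]; lia) hcancel
    rw [this]
  · intro h
    obtain ⟨rfl, rfl⟩ := Prod.mk.inj h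
    obtain ⟨z, hz⟩ := exists_root_FPoly hd.two_le c₀ ζ k₁ i₁
    exact ⟨z, hz, hz⟩
end
end

section
/- Let d be a prime, let ζ ≠ 1 be a d-th root of unity, and let c_0 ∈ ℂ be a root of the Gleason polynomial G_{d,n} for some n ≥ 2. Let k be a positive integer, and write k = nq + r with q ≥ 0 and 0 ≤ r < n. Then f_{d,c_0}^k = (∏_{j=0}^{q−1} ∏_{i=1}^{n−1} (F_{k−nj−i, n−i}^{(d,c_0)})^{d^j}) · ((x − a_{n−r}(c_0)) ∏_{i=1}^{r} F_{r−i, n−i}^{(d,c_0)})^{d^q}, where an empty product is understood to be 1. -/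
open Polynomial IntermediateField

noncomputable section

theorem aSeq_add_of_eq_zero (d : ℕ) {F : Type*} [CommRing F] (c : F) (k : ℕ)
    (h : aSeq d c k = 0) (m : ℕ) : aSeq d c (k + m) = aSeq d c m := by
  induction m with
  | zero => simpa [aSeq] using h
  | succ m ih => rw [← add_assoc, aSeq, aSeq, ih]

theorem aSeq_eq_zero_of_dvd (d : ℕ) {F : Type*} [CommRing F] (c : F) {k n : ℕ}
    (h : aSeq d c k = 0) (hkn : k ∣ n) : aSeq d c n = 0 := by
  obtain ⟨m, rfl⟩ := hkn
  induction m with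
  | zero => rfl
  | succ m ih => rw [mul_add_one, aSeq_add_of_eq_zero d c _ ih, h]

theorem aeval_aPoly (d : ℕ) {F : Type*} [CommRing F] (c : F) (k : ℕ) :
    aeval c (aPoly d k) = aSeq d c k := by
  induction k with
  | zero => simp [aPoly, aSeq]
  | succ k ih => simp [aPoly, aSeq, ih]

theorem isGleasonRoot.aSeq_eq_zero {d n : ℕ} {c₀ : ℂ} (h : isGleasonRoot d n c₀) :
    aSeq d c₀ n = 0 := by
  obtain ⟨g, hg, hg0⟩ := h
  have h0 := congrArg (aeval c₀) hg
  rw [map_mul, hg0, zero_mul, map_prod, eq_comm, Finset.prod_eq_zero_iff] at h0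
  obtain ⟨k, hk, hk0⟩ := h0
  rw [map_pow, aeval_aPoly] at hk0
  exact aSeq_eq_zero_of_dvd d c₀ (eq_zero_of_pow_eq_zero hk0) (Nat.dvd_of_mem_divisors hk)

theorem fIter_succ_sub_aSeq_succ {d : ℕ} (hd : 0 < d) {ζ : ℂ} (hζ : IsPrimitiveRoot ζ d)
    (c : ℂ) (k m : ℕ) :
    fIter d c (k + 1) - C (aSeq d c (m + 1)) =
      FPoly d c ζ k m * (fIter d c k - C (aSeq d c m)) := by
  have h := congrArg (fun p => p.comp (fIter d c k))
    (X_pow_sub_C_eq_prod hζ hd (rfl : aSeq d c m ^ d = _))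
  simp only [sub_comp, X_comp, C_comp, pow_comp, prod_comp] at h
  obtain ⟨e, rfl⟩ : ∃ e, d = e + 1 := ⟨d - 1, by omega⟩
  rw [Finset.prod_range_succ', pow_zero, one_mul] at h
  have hF : FPoly (e + 1) c ζ k m =
      ∏ j ∈ Finset.range e, (fIter (e + 1) c k - C (ζ ^ (j + 1) * aSeq (e + 1) c m)) := by
    rw [FPoly, Nat.add_sub_cancel, ← Finset.Ico_add_one_right_eq_Icc,
      Finset.prod_Ico_eq_prod_range, Nat.add_sub_cancel]
    simp only [add_comm 1]
  rw [hF, ← h]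
  simp [fIter, aSeq]

theorem fIter_add_sub_aSeq_add {d : ℕ} (hd : 0 < d) {ζ : ℂ} (hζ : IsPrimitiveRoot ζ d)
    (c : ℂ) (k m t : ℕ) :
    fIter d c (k + t) - C (aSeq d c (m + t)) =
      (∏ i ∈ Finset.Icc 1 t, FPoly d c ζ (k + t - i) (m + t - i)) *
        (fIter d c k - C (aSeq d c m)) := by
  induction t generalizing k m with
  | zero => simp
  | succ t ih =>
    have h := ih (k + 1) (m + 1)
    rw [fIter_succ_sub_aSeq_succ hd hζ] at h
    rw [Finset.prod_Icc_succ_top (by omega), mul_assoc]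
    simpa [add_assoc, add_comm 1 t] using h

theorem fIter_add_period {d : ℕ} (hd : 0 < d) {ζ : ℂ} (hζ : IsPrimitiveRoot ζ d)
    {c : ℂ} {n : ℕ} (hn : 1 ≤ n) (hc : aSeq d c n = 0) (k : ℕ) :
    fIter d c (k + n) =
      (∏ i ∈ Finset.Icc 1 (n - 1), FPoly d c ζ (k + n - i) (n - i)) * fIter d c k ^ d := by
  obtain ⟨t, rfl⟩ : ∃ t, n = 1 + t := ⟨n - 1, by omega⟩
  have h := fIter_add_sub_aSeq_add hd hζ c (k + 1) 1 t
  rw [hc] at h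
  simpa [fIter, aSeq, hd.ne', add_assoc] using h

/-- Factorization of `f_{d,c₀}^k` for a Gleason parameter `c₀` of period
`n ≥ 2`: writing `k = nq + r` with `0 ≤ r < n`, one has
`f^k = (∏_{j<q} ∏_{1≤i≤n-1} F_{k-nj-i,n-i}^{d^j}) ((x - a_{n-r}) ∏_{1≤i≤r} F_{r-i,n-i})^{d^q}`,
where an empty product is `1`. -/
theorem stmt17 (d : ℕ) (hd : Nat.Prime d) (ζ : ℂ) (hζ1 : ζ ≠ 1) (hζd : ζ ^ d = 1)
    (n : ℕ) (hn : 2 ≤ n)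
    (c₀ : ℂ) (hc₀ : isGleasonRoot d n c₀)
    (k : ℕ) (hk : 1 ≤ k) (q r : ℕ) (hr : r < n) (hkqr : k = n * q + r) :
    fIter d c₀ k =
      (∏ j ∈ Finset.range q, ∏ i ∈ Finset.Icc 1 (n - 1),
          FPoly d c₀ ζ (k - n * j - i) (n - i) ^ d ^ j) *
        ((X - C (aSeq d c₀ (n - r))) *
          ∏ i ∈ Finset.Icc 1 r, FPoly d c₀ ζ (r - i) (n - i)) ^ d ^ q := by
  have hζ : IsPrimitiveRoot ζ d := by
    have := Fact.mk hd
    exact orderOf_eq_prime hζd hζ1 ▸ IsPrimitiveRoot.orderOf ζ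
  have hc := hc₀.aSeq_eq_zero
  clear hk
  induction q generalizing k with
  | zero =>
    have h := fIter_add_sub_aSeq_add hd.pos hζ c₀ 0 (n - r) r
    rw [Nat.sub_add_cancel hr.le, hc] at h
    subst hkqr
    simpa [fIter, mul_comm] using h
  | succ q ih =>
    have hk : k = (n * q + r) + n := by rw [hkqr]; ring
    have hsub (j : ℕ) : k - n * (j + 1) = n * q + r - n * j := by
      rw [hk, mul_add_one]; omega
    rw [Finset.prod_range_succ', hk, fIter_add_period hd.pos hζ (by omega) hc, ih _ rfl, ← hk]
    simp only [hsub, mul_pow, ← Finset.prod_pow, ← pow_mul, ← pow_succ, mul_zero, Nat.sub_zero,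
      pow_zero, pow_one]
    ring
end
end
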